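/- arXiv:2502.06983 — 3 statements merged into one kernel-verified Lean document; each statement's English description precedes it below -/
import Mathlib

section
/- Let T > 0, ρ ≥ 1, let R : [0,T]² → ℝ satisfy R(u,0) = R(0,u) = 0 for all u ∈ [0,T], and let ω be a nonnegative super-additive 2D rectangle function on [0,T]² such that |R_{uv}^{st}|^ρ ≤ ω([u,v]×[s,t]) for every rectangle [u,v]×[s,t] ⊆ [0,T]². Then for every partition 0 = t_0 < ⋯ < t_n = T of [0,T], Σ_{k=0}^{n−1} |R(t_{k+1},t_{k+1}) − R(t_k,t_k)|^ρ ≤ 2^{ρ−1} ω([0,T]²); in particular the diagonal function t ↦ R(t,t) has finite ρ-variation on [0,T], bounded by (2^{ρ−1} ω([0,T]²))^{1/ρ}. -/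
/-- Telescoping of a sum of consecutive differences indexed by `Fin n`. -/
theorem Fin.sum_succ_sub_castSucc {n : ℕ} (f : Fin (n + 1) → ℝ) :
    ∑ k : Fin n, (f k.succ - f k.castSucc) = f (Fin.last n) - f 0 := by
  have h := (Fin.sum_univ_succ f).symm.trans (Fin.sum_univ_castSucc f)
  rw [Finset.sum_sub_distrib]
  linarith

/-- Convexity bound for the `ρ`-th power of the absolute value of a sum. -/
theorem abs_add_rpow_le {ρ : ℝ} (hρ : 1 ≤ ρ) (a b : ℝ) :
    |a + b| ^ ρ ≤ 2 ^ (ρ - 1) * (|a| ^ ρ + |b| ^ ρ) := by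
  have h : (|a| + |b|) ^ ρ ≤ 2 ^ (ρ - 1) * (|a| ^ ρ + |b| ^ ρ) := by
    exact_mod_cast NNReal.rpow_add_le_mul_rpow_add_rpow ⟨|a|, abs_nonneg a⟩ ⟨|b|, abs_nonneg b⟩ hρ
  exact (Real.rpow_le_rpow (abs_nonneg _) (abs_add_le a b) (by linarith)).trans h


/-- Let `R : [0,T]² → ℝ` vanish on the axes, let `w` be a nonnegative super-additive
2D rectangle function on `[0,T]²` controlling the `ρ`-variation of `R`, i.e.
`|R_{uv}^{st}|^ρ ≤ w([u,v]×[s,t])` for every rectangle.  Then for every partition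
`0 = t_0 < ⋯ < t_n = T`,
`Σ_k |R(t_{k+1},t_{k+1}) - R(t_k,t_k)|^ρ ≤ 2^{ρ-1} w([0,T]²)`;
in particular the diagonal `t ↦ R(t,t)` has finite `ρ`-variation bounded by
`(2^{ρ-1} w([0,T]²))^{1/ρ}`. -/
theorem stmt_3 (T ρ : ℝ) (hT : 0 < T) (hρ : 1 ≤ ρ)
    (R : ℝ → ℝ → ℝ)
    (hRaxes : ∀ u ∈ Set.Icc (0 : ℝ) T, R u 0 = 0 ∧ R 0 u = 0)
    (w : ℝ → ℝ → ℝ → ℝ → ℝ)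
    (hnonneg : ∀ a b s t, 0 ≤ a → a ≤ b → b ≤ T → 0 ≤ s → s ≤ t → t ≤ T →
      0 ≤ w a b s t)
    (hsup1 : ∀ a b c s t, 0 ≤ a → a ≤ b → b ≤ c → c ≤ T → 0 ≤ s → s ≤ t → t ≤ T →
      w a b s t + w b c s t ≤ w a c s t)
    (hsup2 : ∀ a b s u t, 0 ≤ a → a ≤ b → b ≤ T → 0 ≤ s → s ≤ u → u ≤ t → t ≤ T →
      w a b s u + w a b u t ≤ w a b s t)
    (hbound : ∀ u v s t, 0 ≤ u → u ≤ v → v ≤ T → 0 ≤ s → s ≤ t → t ≤ T →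
      |R v t - R u t - R v s + R u s| ^ ρ ≤ w u v s t)
    (n : ℕ) (π : Fin (n + 1) → ℝ) (hmono : StrictMono π)
    (h0 : π 0 = 0) (hlast : π (Fin.last n) = T) :
    (∑ k : Fin n, |R (π k.succ) (π k.succ) - R (π k.castSucc) (π k.castSucc)| ^ ρ)
        ≤ 2 ^ (ρ - 1) * w 0 T 0 T ∧
    (∑ k : Fin n, |R (π k.succ) (π k.succ) - R (π k.castSucc) (π k.castSucc)| ^ ρ) ^ (1 / ρ)
        ≤ (2 ^ (ρ - 1) * w 0 T 0 T) ^ (1 / ρ) := by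
  have hmem : ∀ k, 0 ≤ π k ∧ π k ≤ T := fun k =>
    ⟨h0 ▸ hmono.monotone (Fin.zero_le k), hlast ▸ hmono.monotone (Fin.le_last k)⟩
  have hC : (0 : ℝ) ≤ 2 ^ (ρ - 1) := by positivity
  -- The increment splits into the two rectangles whose union is `[0,t]² \ [0,s]²`.
  have hstep : ∀ s t, 0 ≤ s → s ≤ t → t ≤ T →
      |R t t - R s s| ^ ρ ≤ 2 ^ (ρ - 1) * (w 0 t 0 t - w 0 s 0 s) := by
    intro s t hs hst htT
    have ht : 0 ≤ t := hs.trans hst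
    have hsT : s ≤ T := hst.trans htT
    have b1 := hbound s t 0 t hs hst htT le_rfl ht htT
    have b2 := hbound 0 s s t le_rfl hs hsT hs hst htT
    have s1 := hsup1 0 s t 0 t le_rfl hs hst htT le_rfl ht htT
    have s2 := hsup2 0 s 0 s t le_rfl hs hsT le_rfl hs hst htT
    have hsplit : R t t - R s s =
        (R t t - R s t - R t 0 + R s 0) + (R s t - R 0 t - R s s + R 0 s) := by
      rw [(hRaxes t ⟨ht, htT⟩).1, (hRaxes s ⟨hs, hsT⟩).1, (hRaxes t ⟨ht, htT⟩).2,
        (hRaxes s ⟨hs, hsT⟩).2]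
      ring
    rw [hsplit]
    refine (abs_add_rpow_le hρ _ _).trans (mul_le_mul_of_nonneg_left ?_ hC)
    linarith
  have hmain : (∑ k : Fin n, |R (π k.succ) (π k.succ) - R (π k.castSucc) (π k.castSucc)| ^ ρ)
      ≤ 2 ^ (ρ - 1) * w 0 T 0 T := by
    calc _ ≤ ∑ k : Fin n, 2 ^ (ρ - 1) *
          (w 0 (π k.succ) 0 (π k.succ) - w 0 (π k.castSucc) 0 (π k.castSucc)) :=
          Finset.sum_le_sum fun k _ => hstep _ _ (hmem _).1
            (hmono.monotone k.castSucc_lt_succ.le) (hmem _).2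
      _ = 2 ^ (ρ - 1) * (w 0 T 0 T - w 0 0 0 0) := by
          rw [← Finset.mul_sum, Fin.sum_succ_sub_castSucc fun k => w 0 (π k) 0 (π k), h0, hlast]
      _ ≤ 2 ^ (ρ - 1) * w 0 T 0 T :=
          mul_le_mul_of_nonneg_left
            (sub_le_self _ (hnonneg 0 0 0 0 le_rfl le_rfl hT.le le_rfl le_rfl hT.le)) hC
  exact ⟨hmain, Real.rpow_le_rpow
    (Finset.sum_nonneg fun k _ => Real.rpow_nonneg (abs_nonneg _) _) hmain (by positivity)⟩
end

section
/- Let T > 0, ρ ≥ 1, α > ρ, let R : [0,T]² → ℝ be continuous, and let ω be a nonnegative super-additive 2D rectangle function on [0,T]² such that |R_{uv}^{st}|^ρ ≤ ω([u,v]×[s,t]) for every rectangle [u,v]×[s,t] ⊆ [0,T]². Then for every ε > 0 there exists δ > 0 such that for every partition 0 = t_0 < ⋯ < t_n = T of [0,T] with mesh < δ one has Σ_{k=0}^{n−1} Σ_{k'=0}^{n−1} | R_{t_k t_{k+1}}^{t_{k'} t_{k'+1}} |^α < ε. -/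
/-- The sum of a super-additive interval function over a partition is at most its value on the
whole interval. -/
theorem sum_le_of_superadditive {c d : ℝ} (f : ℝ → ℝ → ℝ)
    (hdiag : ∀ a, c ≤ a → a ≤ d → 0 ≤ f a a)
    (hsup : ∀ x y z, c ≤ x → x ≤ y → y ≤ z → z ≤ d → f x y + f y z ≤ f x z) (n : ℕ)
    (p : Fin (n + 1) → ℝ) (hp : Monotone p) (h0 : c ≤ p 0) (hd : p (Fin.last n) ≤ d) :
    ∑ k : Fin n, f (p k.castSucc) (p k.succ) ≤ f (p 0) (p (Fin.last n)) := by
  induction n with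
  | zero => simpa using hdiag _ h0 hd
  | succ n ih =>
    rw [Fin.sum_univ_castSucc]
    have hle : p (Fin.last n).castSucc ≤ p (Fin.last (n + 1)) := hp (Fin.le_last _)
    have hinit := ih (fun k => p k.castSucc)
      (fun i j hij => hp (Fin.castSucc_le_castSucc_iff.2 hij)) h0 (hle.trans hd)
    have hlast := hsup (p 0) (p (Fin.last n).castSucc) (p (Fin.last (n + 1))) h0
      (hp (Fin.zero_le _)) hle hd
    simp only [Fin.castSucc_zero, Fin.succ_castSucc, Fin.succ_last] at hinit hlast ⊢
    linarith

/-- Let `R : [0,T]² → ℝ` be continuous and let `w` be a nonnegative super-additive 2D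
rectangle function on `[0,T]²` with `|R_{uv}^{st}|^ρ ≤ w([u,v]×[s,t])` for all rectangles.
If `α > ρ`, then `Σ_k Σ_{k'} |R_{t_k t_{k+1}}^{t_{k'} t_{k'+1}}|^α` over partitions of
`[0,T]` tends to `0` as the mesh tends to `0`. -/
theorem stmt_8 (T ρ α : ℝ) (hT : 0 < T) (hρ : 1 ≤ ρ) (hρα : ρ < α)
    (R : ℝ → ℝ → ℝ)
    (hRc : ContinuousOn (fun q : ℝ × ℝ => R q.1 q.2)
      (Set.Icc 0 T ×ˢ Set.Icc 0 T))
    (w : ℝ → ℝ → ℝ → ℝ → ℝ)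
    (hnonneg : ∀ a b s t, 0 ≤ a → a ≤ b → b ≤ T → 0 ≤ s → s ≤ t → t ≤ T →
      0 ≤ w a b s t)
    (hsup1 : ∀ a b c s t, 0 ≤ a → a ≤ b → b ≤ c → c ≤ T → 0 ≤ s → s ≤ t → t ≤ T →
      w a b s t + w b c s t ≤ w a c s t)
    (hsup2 : ∀ a b s u t, 0 ≤ a → a ≤ b → b ≤ T → 0 ≤ s → s ≤ u → u ≤ t → t ≤ T →
      w a b s u + w a b u t ≤ w a b s t)
    (hbound : ∀ u v s t, 0 ≤ u → u ≤ v → v ≤ T → 0 ≤ s → s ≤ t → t ≤ T →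
      |R v t - R u t - R v s + R u s| ^ ρ ≤ w u v s t) :
    ∀ ε > 0, ∃ δ > 0, ∀ (n : ℕ) (π : Fin (n + 1) → ℝ), StrictMono π → π 0 = 0 →
      π (Fin.last n) = T → (∀ k : Fin n, π k.succ - π k.castSucc < δ) →
      ∑ k : Fin n, ∑ k' : Fin n,
          |R (π k.succ) (π k'.succ) - R (π k.castSucc) (π k'.succ)
            - R (π k.succ) (π k'.castSucc) + R (π k.castSucc) (π k'.castSucc)| ^ α
        < ε := by
  intro ε hε
  have hM : 0 ≤ w 0 T 0 T := hnonneg _ _ _ _ le_rfl hT.le le_rfl le_rfl hT.le le_rfl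
  obtain ⟨η, hη, hηε⟩ : ∃ η : ℝ, 0 < η ∧ η ^ (α - ρ) * w 0 T 0 T < ε := by
    have hcont : Filter.Tendsto (fun x : ℝ => x ^ (α - ρ) * w 0 T 0 T) (nhdsWithin 0 (Set.Ioi 0))
        (nhds 0) := by
      have h := ((Real.continuousAt_rpow_const 0 (α - ρ) (Or.inr (by linarith))).mul_const
        (w 0 T 0 T)).tendsto
      rw [Real.zero_rpow (by linarith), zero_mul] at h
      exact h.mono_left nhdsWithin_le_nhds
    obtain ⟨η, hηε, hη⟩ := ((hcont.eventually_lt_const hε).and self_mem_nhdsWithin).exists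
    exact ⟨η, hη, hηε⟩
  have hunif := (isCompact_Icc.prod isCompact_Icc).uniformContinuousOn_of_continuous hRc
  obtain ⟨δ, hδ, hR⟩ := Metric.uniformContinuousOn_iff.1 hunif (η / 2) (half_pos hη)
  refine ⟨δ, hδ, fun n π hπ h0 hlast hmesh => ?_⟩
  have hmem : ∀ i, 0 ≤ π i ∧ π i ≤ T := fun i =>
    ⟨h0 ▸ hπ.monotone (Fin.zero_le i), hlast ▸ hπ.monotone (Fin.le_last i)⟩
  have hstep : ∀ k : Fin n, π k.castSucc ≤ π k.succ := fun k =>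
    hπ.monotone (Fin.castSucc_lt_succ).le
  have hterm : ∀ k k' : Fin n,
      |R (π k.succ) (π k'.succ) - R (π k.castSucc) (π k'.succ)
        - R (π k.succ) (π k'.castSucc) + R (π k.castSucc) (π k'.castSucc)| ^ α
      ≤ η ^ (α - ρ) * w (π k.castSucc) (π k.succ) (π k'.castSucc) (π k'.succ) := by
    intro k k'
    have hdiff : ∀ j, |R (π k.succ) (π j) - R (π k.castSucc) (π j)| < η / 2 := by
      intro j
      have h := hR (π k.succ, π j) ⟨hmem _, hmem _⟩ (π k.castSucc, π j) ⟨hmem _, hmem _⟩ (by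
        rw [Prod.dist_eq, dist_self, Real.dist_eq, abs_of_nonneg (sub_nonneg.2 (hstep k))]
        exact max_lt (hmesh k) hδ)
      rwa [Real.dist_eq] at h
    have hb := hbound _ _ _ _ (hmem k.castSucc).1 (hstep k) (hmem k.succ).2
      (hmem k'.castSucc).1 (hstep k') (hmem k'.succ).2
    set x := |R (π k.succ) (π k'.succ) - R (π k.castSucc) (π k'.succ)
        - R (π k.succ) (π k'.castSucc) + R (π k.castSucc) (π k'.castSucc)| with hx
    have hxη : x ≤ η := by
      have h1 := abs_lt.1 (hdiff k'.succ)
      have h2 := abs_lt.1 (hdiff k'.castSucc)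
      rw [hx, abs_le]
      constructor <;> linarith [h1.1, h1.2, h2.1, h2.2]
    have hx0 : 0 ≤ x := abs_nonneg _
    calc x ^ α = x ^ (α - ρ) * x ^ ρ := by
          rw [← Real.rpow_add_of_nonneg hx0 (by linarith) (by linarith), sub_add_cancel]
      _ ≤ _ := mul_le_mul (Real.rpow_le_rpow hx0 hxη (by linarith)) hb
          (Real.rpow_nonneg hx0 _) (Real.rpow_nonneg hη.le _)
  have hrow : ∀ k : Fin n,
      ∑ k' : Fin n, w (π k.castSucc) (π k.succ) (π k'.castSucc) (π k'.succ)
        ≤ w (π k.castSucc) (π k.succ) 0 T := by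
    intro k
    have h := sum_le_of_superadditive (w (π k.castSucc) (π k.succ))
      (fun a ha haT => hnonneg _ _ _ _ (hmem _).1 (hstep k) (hmem _).2 ha le_rfl haT)
      (fun x y z hx hxy hyz hz => hsup2 _ _ _ _ _ (hmem _).1 (hstep k) (hmem _).2 hx hxy hyz hz)
      n π hπ.monotone h0.ge hlast.le
    rwa [h0, hlast] at h
  have hcol : ∑ k : Fin n, w (π k.castSucc) (π k.succ) 0 T ≤ w 0 T 0 T := by
    have h := sum_le_of_superadditive (fun a b => w a b 0 T)
      (fun a ha haT => hnonneg _ _ _ _ ha le_rfl haT le_rfl hT.le le_rfl)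
      (fun x y z hx hxy hyz hz => hsup1 _ _ _ _ _ hx hxy hyz hz le_rfl hT.le le_rfl)
      n π hπ.monotone h0.ge hlast.le
    rwa [h0, hlast] at h
  calc _ ≤ ∑ k : Fin n, ∑ k' : Fin n,
        η ^ (α - ρ) * w (π k.castSucc) (π k.succ) (π k'.castSucc) (π k'.succ) :=
        Finset.sum_le_sum fun k _ => Finset.sum_le_sum fun k' _ => hterm k k'
    _ = η ^ (α - ρ) * ∑ k : Fin n, ∑ k' : Fin n,
        w (π k.castSucc) (π k.succ) (π k'.castSucc) (π k'.succ) := by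
        simp only [Finset.mul_sum]
    _ ≤ η ^ (α - ρ) * w 0 T 0 T :=
        mul_le_mul_of_nonneg_left ((Finset.sum_le_sum fun k _ => hrow k).trans hcol)
          (Real.rpow_nonneg hη.le _)
    _ < ε := hηε
end

section
/- Let T > 0, θ > 1, and let g : {(a,b) : 0 ≤ a ≤ b ≤ T} → ℝ be nonnegative, continuous, with g(a,a) = 0 for all a ∈ [0,T], and super-additive in the sense that g(a,b) + g(b,c) ≤ g(a,c) whenever 0 ≤ a ≤ b ≤ c ≤ T. Then for every ε > 0 there exists δ > 0 such that for every partition 0 = t_0 < ⋯ < t_n = T of [0,T] with mesh < δ one has Σ_{k=0}^{n−1} g(t_k, t_{k+1})^θ < ε. -/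
/-- The sum of a super-additive function over a partition is at most its value on the endpoints. -/
theorem sum_le_of_superadditive_s9 {T : ℝ} {g : ℝ → ℝ → ℝ}
    (hdiag : ∀ a ∈ Set.Icc (0 : ℝ) T, g a a = 0)
    (hsup : ∀ a b c, 0 ≤ a → a ≤ b → b ≤ c → c ≤ T → g a b + g b c ≤ g a c)
    (n : ℕ) (π : Fin (n + 1) → ℝ) (hπ : Monotone π) (hmem : ∀ k, π k ∈ Set.Icc (0 : ℝ) T) :
    ∑ k : Fin n, g (π k.castSucc) (π k.succ) ≤ g (π 0) (π (Fin.last n)) := by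
  induction n with
  | zero => simp [hdiag _ (hmem 0)]
  | succ n ih =>
    rw [Fin.sum_univ_castSucc]
    have h := ih (fun k => π k.castSucc)
      (fun _ _ hij => hπ (Fin.castSucc_le_castSucc_iff.2 hij)) (fun k => hmem _)
    have h' := hsup (π 0) (π (Fin.last n).castSucc) (π (Fin.last (n + 1))) (hmem _).1
      (hπ (Fin.zero_le _)) (hπ (Fin.le_last _)) (hmem _).2
    simp only [Fin.succ_castSucc, Fin.succ_last, Fin.castSucc_zero] at h h' ⊢
    linarith

/-- A continuous function on the simplex vanishing on the diagonal is uniformly small near it. -/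
theorem exists_forall_lt_of_sub_lt {T : ℝ} {g : ℝ → ℝ → ℝ}
    (hcont : ContinuousOn (fun q : ℝ × ℝ => g q.1 q.2)
      {q : ℝ × ℝ | 0 ≤ q.1 ∧ q.1 ≤ q.2 ∧ q.2 ≤ T})
    (hdiag : ∀ a ∈ Set.Icc (0 : ℝ) T, g a a = 0) {η : ℝ} (hη : 0 < η) :
    ∃ δ > 0, ∀ a b, 0 ≤ a → a ≤ b → b ≤ T → b - a < δ → g a b < η := by
  have hcompact : IsCompact {q : ℝ × ℝ | 0 ≤ q.1 ∧ q.1 ≤ q.2 ∧ q.2 ≤ T} := by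
    refine (isCompact_Icc (a := ((0 : ℝ), (0 : ℝ))) (b := (T, T))).of_isClosed_subset ?_ ?_
    · exact (isClosed_le continuous_const continuous_fst).inter
        ((isClosed_le continuous_fst continuous_snd).inter
          (isClosed_le continuous_snd continuous_const))
    · rintro ⟨a, b⟩ ⟨h₁, h₂, h₃⟩
      exact ⟨⟨h₁, h₁.trans h₂⟩, ⟨h₂.trans h₃, h₃⟩⟩
  obtain ⟨δ, hδ, h⟩ := Metric.uniformContinuousOn_iff.1
    (hcompact.uniformContinuousOn_of_continuous hcont) η hη
  refine ⟨δ, hδ, fun a b ha hab hb hlt => ?_⟩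
  have hdist := h (a, b) ⟨ha, hab, hb⟩ (a, a) ⟨ha, le_rfl, hab.trans hb⟩ (by
    simpa [Prod.dist_eq, Real.dist_eq, abs_of_nonneg (sub_nonneg.2 hab)] using ⟨hδ, hlt⟩)
  simp only [hdiag a ⟨ha, hab.trans hb⟩, Real.dist_eq, sub_zero] at hdist
  exact (le_abs_self _).trans_lt hdist

/-- Let `g` be a nonnegative continuous super-additive function on the simplex
`{(a,b) : 0 ≤ a ≤ b ≤ T}` vanishing on the diagonal, and let `θ > 1`.  Then
`Σ_k g(t_k, t_{k+1})^θ` over partitions of `[0,T]` tends to `0` as the mesh tends to `0`. -/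
theorem stmt_9 (T θ : ℝ) (hT : 0 < T) (hθ : 1 < θ)
    (g : ℝ → ℝ → ℝ)
    (hnonneg : ∀ a b, 0 ≤ a → a ≤ b → b ≤ T → 0 ≤ g a b)
    (hcont : ContinuousOn (fun q : ℝ × ℝ => g q.1 q.2)
      {q : ℝ × ℝ | 0 ≤ q.1 ∧ q.1 ≤ q.2 ∧ q.2 ≤ T})
    (hdiag : ∀ a ∈ Set.Icc (0 : ℝ) T, g a a = 0)
    (hsup : ∀ a b c, 0 ≤ a → a ≤ b → b ≤ c → c ≤ T → g a b + g b c ≤ g a c) :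
    ∀ ε > 0, ∃ δ > 0, ∀ (n : ℕ) (π : Fin (n + 1) → ℝ), StrictMono π → π 0 = 0 →
      π (Fin.last n) = T → (∀ k : Fin n, π k.succ - π k.castSucc < δ) →
      ∑ k : Fin n, g (π k.castSucc) (π k.succ) ^ θ < ε := by
  intro ε hε
  have hG : 0 ≤ g 0 T := hnonneg 0 T le_rfl hT.le le_rfl
  have hθ' : 0 < θ - 1 := sub_pos.2 hθ
  set c := ε / (g 0 T + 1)
  have hc : 0 < c := by positivity
  obtain ⟨δ, hδ, hsmall⟩ := exists_forall_lt_of_sub_lt hcont hdiag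
    (Real.rpow_pos_of_pos hc (θ - 1)⁻¹)
  refine ⟨δ, hδ, fun n π hπ h0 hn hmesh => ?_⟩
  have hmem : ∀ k, π k ∈ Set.Icc (0 : ℝ) T := fun k =>
    ⟨h0 ▸ hπ.monotone (Fin.zero_le k), hn ▸ hπ.monotone (Fin.le_last k)⟩
  have hterm : ∀ k : Fin n,
      g (π k.castSucc) (π k.succ) ^ θ ≤ c * g (π k.castSucc) (π k.succ) := by
    intro k
    have hle : π k.castSucc ≤ π k.succ := hπ.monotone (Fin.castSucc_lt_succ).le
    have hg := hnonneg _ _ (hmem k.castSucc).1 hle (hmem k.succ).2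
    have hlt := hsmall _ _ (hmem k.castSucc).1 hle (hmem k.succ).2 (hmesh k)
    have hpow := Real.rpow_le_rpow hg hlt.le hθ'.le
    rw [Real.rpow_inv_rpow hc.le hθ'.ne'] at hpow
    calc g (π k.castSucc) (π k.succ) ^ θ
        = g (π k.castSucc) (π k.succ) ^ (θ - 1) * g (π k.castSucc) (π k.succ) := by
          rw [← Real.rpow_add_one' hg (by linarith), sub_add_cancel]
      _ ≤ c * g (π k.castSucc) (π k.succ) := mul_le_mul_of_nonneg_right hpow hg
  have hsum := sum_le_of_superadditive_s9 hdiag hsup n π hπ.monotone hmem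
  rw [h0, hn] at hsum
  calc ∑ k : Fin n, g (π k.castSucc) (π k.succ) ^ θ
      ≤ ∑ k : Fin n, c * g (π k.castSucc) (π k.succ) := Finset.sum_le_sum fun k _ => hterm k
    _ = c * ∑ k : Fin n, g (π k.castSucc) (π k.succ) := (Finset.mul_sum _ _ _).symm
    _ ≤ c * g 0 T := mul_le_mul_of_nonneg_left hsum hc.le
    _ < c * (g 0 T + 1) := by linarith
    _ = ε := div_mul_cancel₀ _ (by positivity)
end
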